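/- Let Y be a random element of ℝ₀^{ℤ^d} satisfying the tail-process identity with P(Y ∈ E₀) = 1. Then for every anchoring function A with P(A(Y) = 0) > 0 one has P(A(Y) = 0) = E[1/|e(Y)|] =: ϑ; in particular the probability P(A(Y) = 0) does not depend on the choice of the anchoring function A. -/

import Mathlib

open MeasureTheory ENNReal Filter ProbabilityTheory

noncomputable section

/-- The space `ℝ^{ℤ^d}` of real-valued fields indexed by `ℤ^d`. -/
abbrev RField (d : ℕ) := (Fin d → ℤ) → ℝ

variable {d : ℕ}

/-- Shift operator: `shift k x = (x_{i+k})_i`, i.e. it moves the origin to `k`. -/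
def shift (k : Fin d → ℤ) (x : RField d) : RField d := fun i => x (i + k)

/-- The set of exceedance-points of `x`. -/
def excSet (x : RField d) : Set (Fin d → ℤ) := {k | 1 < |x k|}

open Classical in
/-- Indicator (with values in `ℝ≥0∞`) of the event that `|x k| > s`. -/
def exIndGT (s : ℝ) (k : Fin d → ℤ) (x : RField d) : ℝ≥0∞ := if s < |x k| then 1 else 0

/-- The tail-process identity:
`E[h(θ_k Y) 1{|Y_k| > 1}] = E[h(Y) 1{|Y_{−k}| > 1}]` for every measurable nonnegative `h`
and every `k ∈ ℤ^d`. -/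
def TailIdentity {Ω : Type*} [MeasurableSpace Ω] (μ : Measure Ω) (Y : Ω → RField d) : Prop :=
  ∀ h : RField d → ℝ≥0∞, Measurable h → ∀ k : Fin d → ℤ,
    ∫⁻ ω, h (shift k (Y ω)) * exIndGT 1 k (Y ω) ∂μ
      = ∫⁻ ω, h (Y ω) * exIndGT 1 (-k) (Y ω) ∂μ

/-- `Y` is exceedance-stationary: for every exceedance-map `τ` which is bijective on a
measurable set `B` (invariant under shifting the origin to exceedance-points, contained in
`ℝ₀^{ℤ^d}`) carrying the law of `Y`, we have `θ_τ Y ≐ Y`. -/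
def ExcStationary {Ω : Type*} [MeasurableSpace Ω] (μ : Measure Ω) (Y : Ω → RField d) : Prop :=
  ∀ (B : Set (RField d)) (τ : RField d → Fin d → ℤ),
    MeasurableSet B → Measurable τ →
    (∀ x ∈ B, 1 < |x 0|) →
    (∀ x ∈ B, ∀ k ∈ excSet x, shift k x ∈ B) →
    (∀ x ∈ B, τ x ∈ excSet x) →
    (∀ x ∈ B, Set.BijOn (fun k => k + τ (shift k x)) (excSet x) (excSet x)) →
    (∀ᵐ ω ∂μ, Y ω ∈ B) →
    Measure.map (fun ω => shift (τ (Y ω)) (Y ω)) μ = Measure.map Y μ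

/-- `E₀`: elements of `ℝ₀^{ℤ^d}` with finitely many exceedance-points. -/
def E0set (d : ℕ) : Set (RField d) := {x | 1 < |x 0| ∧ (excSet x).Finite}

/-- `E`: elements of `ℝ^{ℤ^d}` with at least one but finitely many exceedance-points. -/
def Eset (d : ℕ) : Set (RField d) := {x | (excSet x).Nonempty ∧ (excSet x).Finite}

/-- `l₀`: fields vanishing at infinity. -/
def l0set (d : ℕ) : Set (RField d) := {x | Tendsto (fun i => |x i|) cofinite (nhds 0)}

/-- Uniform norm `‖x‖ = sup_i |x_i|`. -/
def supNorm (x : RField d) : ℝ := ⨆ i, |x i|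

/-- `V` is Pareto(α)-distributed: `P(V > y) = y^{-α}` for `y ≥ 1`. -/
def IsPareto {Ω : Type*} [MeasurableSpace Ω] (μ : Measure Ω) (V : Ω → ℝ) (α : ℝ) : Prop :=
  ∀ y : ℝ, 1 ≤ y → μ {ω | y < V ω} = ENNReal.ofReal (y ^ (-α))

/-- An anchoring function on `S`: a measurable shift-covariant exceedance-map. -/
def IsAnchoringOn (S : Set (RField d)) (A : RField d → Fin d → ℤ) : Prop :=
  Measurable A ∧ ∀ x ∈ S, A x ∈ excSet x ∧ ∀ k ∈ excSet x, A (shift k x) + k = A x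

/-- `h` is shift-invariant on `S`. -/
def ShiftInvariantOn (S : Set (RField d)) (h : RField d → ℝ≥0∞) : Prop :=
  ∀ x ∈ S, ∀ k : Fin d → ℤ, h (shift k x) = h x

lemma measurable_shift (k : Fin d → ℤ) : Measurable (shift k) :=
  measurable_pi_lambda _ fun i => measurable_pi_apply (i + k)

lemma measurable_exIndGT (s : ℝ) (k : Fin d → ℤ) : Measurable (exIndGT s k) :=
  Measurable.ite (measurableSet_lt measurable_const (measurable_pi_apply k).abs)
    measurable_const measurable_const

lemma tsum_exIndGT_one (x : RField d) :
    ∑' k, exIndGT 1 k x = ((excSet x).encard : ℝ≥0∞) := by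
  classical
  rw [← ENNReal.tsum_set_one, tsum_subtype (excSet x) (fun _ => (1 : ℝ≥0∞))]
  refine tsum_congr fun k => ?_
  simp only [exIndGT, Set.indicator_apply, excSet, Set.mem_ofPred_eq]

lemma measurable_inv_encard_excSet :
    Measurable fun x : RField d => ((excSet x).encard : ℝ≥0∞)⁻¹ := by
  simp_rw [← tsum_exIndGT_one]
  exact (Measurable.tsum fun k => measurable_exIndGT 1 k).inv

lemma encard_excSet_shift (k : Fin d → ℤ) (x : RField d) :
    (excSet (shift k x)).encard = (excSet x).encard :=
  Set.encard_preimage_of_bijective (Equiv.addRight k).bijective (excSet x)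

lemma inv_encard_mul_encard_excSet {x : RField d} (hx : x ∈ E0set d) :
    ((excSet x).encard : ℝ≥0∞)⁻¹ * ((excSet x).encard : ℝ≥0∞) = 1 := by
  have h0 : (excSet x).encard ≠ 0 := Set.encard_ne_zero.mpr ⟨0, hx.1⟩
  have ht : (excSet x).encard ≠ ⊤ := Set.encard_ne_top_iff.mpr hx.2
  exact ENNReal.inv_mul_cancel (by simpa using h0) (by simpa using ht)

/-- Exactly one exceedance-point of `x ∈ E₀` has the anchor at the origin after shifting to it. -/
lemma tsum_anchor_mul_exIndGT {A : RField d → Fin d → ℤ} (hA : IsAnchoringOn (E0set d) A)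
    {x : RField d} (hx : x ∈ E0set d) :
    ∑' k, {y | A y = 0}.indicator (1 : RField d → ℝ≥0∞) (shift k x) * exIndGT 1 k x = 1 := by
  classical
  obtain ⟨hmem, hcov⟩ := hA.2 x hx
  rw [tsum_eq_single (A x)]
  · have h : A (shift (A x) x) = 0 := by simpa using hcov _ hmem
    have h' : 1 < |x (A x)| := hmem
    simp [exIndGT, h, h']
  · intro k hk
    by_cases hke : 1 < |x k|
    · have h : A (shift k x) ≠ 0 := fun h => hk (by simpa [h] using hcov k hke)
      simp [h]
    · simp [exIndGT, hke]

/-- If `Y` satisfies the tail-process identity and `P(Y ∈ E₀) = 1`, then for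
every anchoring function `A` with `P(A(Y) = 0) > 0` one has `P(A(Y) = 0) = E[1/|e(Y)|] =: ϑ`;
in particular this probability does not depend on the choice of `A`. -/
theorem anchor_probability_eq_extremal_index
    {Ω : Type*} [MeasurableSpace Ω] (μ : Measure Ω) [IsProbabilityMeasure μ]
    (Y : Ω → RField d) (hY : Measurable Y) (hTI : TailIdentity μ Y)
    (hE0 : ∀ᵐ ω ∂μ, Y ω ∈ E0set d)
    (A : RField d → Fin d → ℤ) (hA : IsAnchoringOn (E0set d) A)
    (hpos : 0 < μ {ω | A (Y ω) = 0}) :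
    μ {ω | A (Y ω) = 0} = ∫⁻ ω, ((excSet (Y ω)).encard)⁻¹ ∂μ := by
  have hS : MeasurableSet {x | A x = 0} := hA.1 (measurableSet_singleton 0)
  set f : RField d → ℝ≥0∞ := {x | A x = 0}.indicator 1 with hf
  set g : RField d → ℝ≥0∞ := fun x => ((excSet x).encard : ℝ≥0∞)⁻¹ with hg
  have hfm : Measurable f := measurable_one.indicator hS
  have hgm : Measurable g := measurable_inv_encard_excSet
  have hgs (k : Fin d → ℤ) (x : RField d) : g (shift k x) = g x := by
    simp only [hg, encard_excSet_shift]
  have hsum (x : RField d) : ∑' k, exIndGT 1 (-k) x = ((excSet x).encard : ℝ≥0∞) := by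
    rw [← tsum_exIndGT_one]
    exact (Equiv.neg (Fin d → ℤ)).tsum_eq (fun k => exIndGT 1 k x)
  symm
  calc ∫⁻ ω, g (Y ω) ∂μ
      = ∫⁻ ω, ∑' k, (g * f) (shift k (Y ω)) * exIndGT 1 k (Y ω) ∂μ := by
        refine lintegral_congr_ae (hE0.mono fun ω hω => ?_)
        simp only [Pi.mul_apply, hgs, mul_assoc, ENNReal.tsum_mul_left]
        rw [hf, tsum_anchor_mul_exIndGT hA hω, mul_one]
    _ = ∑' k, ∫⁻ ω, (g * f) (shift k (Y ω)) * exIndGT 1 k (Y ω) ∂μ :=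
        lintegral_tsum fun k => ((((hgm.mul hfm).comp (measurable_shift k)).mul
          (measurable_exIndGT 1 k)).comp hY).aemeasurable
    _ = ∑' k, ∫⁻ ω, (g * f) (Y ω) * exIndGT 1 (-k) (Y ω) ∂μ :=
        tsum_congr (hTI _ (hgm.mul hfm))
    _ = ∫⁻ ω, ∑' k, (g * f) (Y ω) * exIndGT 1 (-k) (Y ω) ∂μ :=
        (lintegral_tsum fun k => (((hgm.mul hfm).mul
          (measurable_exIndGT 1 (-k))).comp hY).aemeasurable).symm
    _ = ∫⁻ ω, f (Y ω) ∂μ := by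
        refine lintegral_congr_ae (hE0.mono fun ω hω => ?_)
        simp only [ENNReal.tsum_mul_left, hsum, Pi.mul_apply]
        rw [mul_right_comm, inv_encard_mul_encard_excSet hω, one_mul]
    _ = μ {ω | A (Y ω) = 0} := lintegral_indicator_one (hY hS)
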